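/- Let χ be a finite nonempty type and let (Z, R₁, R₂, R₃) have a strictly positive joint distribution on χ × Bool³ satisfying R₃ ⊥ (Z, R₁) | R₂ (the conditional independence implied by the missing data graph of Figure 6(a), where Z₃⁽¹⁾ → R₁, Z₃⁽¹⁾ → R₂, R₁ → R₂, R₂ → R₃). Then for all z, r₁, r₂, r₃: P(Z = z, R₁ = r₁, R₂ = r₂, R₃ = r₃) = [P(Z = z, R₁ = r₁, R₂ = r₂, R₃ = 1) / P(R₃ = 1 | R₂ = r₂)] · P(R₃ = r₃ | R₂ = r₂). Since Z is observed exactly on the event {R₃ = 1} and (R₁, R₂, R₃) are always observed, every factor on the right-hand side is a functional of the observed data law; hence the full observability law of this model is identified. -/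

import Mathlib

open scoped BigOperators

/-- Probability of the event `A` under the (finitely supported) law `P`. -/
noncomputable def Pr {Ω : Type*} [Fintype Ω] (P : Ω → ℝ) (A : Set Ω) : ℝ :=
  ∑ ω, A.indicator P ω

/-- Conditional probability `P(A | B) = P(A ∩ B) / P(B)`. -/
noncomputable def cPr {Ω : Type*} [Fintype Ω] (P : Ω → ℝ) (A B : Set Ω) : ℝ :=
  Pr P (A ∩ B) / Pr P B

lemma Pr_mono {Ω : Type*} [Fintype Ω] {P : Ω → ℝ} (hP : ∀ ω, 0 ≤ P ω) {A B : Set Ω}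
    (h : A ⊆ B) : Pr P A ≤ Pr P B :=
  Finset.sum_le_sum fun ω _ => Set.indicator_le_indicator_of_subset h hP ω

/-- The worked identification example of Theorem 4 (Figure 6(a)):
if `R₃ ⊥ (Z, R₁) | R₂` with a strictly positive joint law, then
`P(Z=z, R₁=r₁, R₂=r₂, R₃=r₃)
  = [P(Z=z, R₁=r₁, R₂=r₂, R₃=1) / P(R₃=1 | R₂=r₂)] · P(R₃=r₃ | R₂=r₂)`,
so the full observability law is identified from the observed data. -/
theorem stmt_9 {Ω χ : Type*} [Fintype Ω] [Fintype χ] [Nonempty χ]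
    (P : Ω → ℝ) (hP : ∀ ω, 0 ≤ P ω) (hPsum : ∑ ω, P ω = 1)
    (Z : Ω → χ) (R₁ R₂ R₃ : Ω → Bool)
    (hpos : ∀ (z : χ) (a b c : Bool),
      0 < Pr P {ω | Z ω = z ∧ R₁ ω = a ∧ R₂ ω = b ∧ R₃ ω = c})
    (hCI : ∀ (b : Bool) (c : Bool) (z : χ) (a : Bool),
      cPr P {ω | R₃ ω = c ∧ Z ω = z ∧ R₁ ω = a} {ω | R₂ ω = b}
        = cPr P {ω | R₃ ω = c} {ω | R₂ ω = b}
          * cPr P {ω | Z ω = z ∧ R₁ ω = a} {ω | R₂ ω = b}) :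
    ∀ (z : χ) (r₁ r₂ r₃ : Bool),
      Pr P {ω | Z ω = z ∧ R₁ ω = r₁ ∧ R₂ ω = r₂ ∧ R₃ ω = r₃}
        = Pr P {ω | Z ω = z ∧ R₁ ω = r₁ ∧ R₂ ω = r₂ ∧ R₃ ω = true}
            / cPr P {ω | R₃ ω = true} {ω | R₂ ω = r₂}
          * cPr P {ω | R₃ ω = r₃} {ω | R₂ ω = r₂} := by
  intro z r₁ r₂ r₃
  have hB : 0 < Pr P {ω | R₂ ω = r₂} :=
    (hpos z r₁ r₂ true).trans_le (Pr_mono hP fun _ h => h.2.2.1)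
  have hC : 0 < cPr P {ω | R₃ ω = true} {ω | R₂ ω = r₂} :=
    div_pos ((hpos z r₁ r₂ true).trans_le (Pr_mono hP fun _ h => ⟨h.2.2.2, h.2.2.1⟩)) hB
  have joint_eq (c : Bool) :
      Pr P {ω | Z ω = z ∧ R₁ ω = r₁ ∧ R₂ ω = r₂ ∧ R₃ ω = c}
        = cPr P {ω | R₃ ω = c} {ω | R₂ ω = r₂}
          * cPr P {ω | Z ω = z ∧ R₁ ω = r₁} {ω | R₂ ω = r₂} * Pr P {ω | R₂ ω = r₂} := by
    rw [← hCI, cPr, div_mul_cancel₀ _ hB.ne']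
    congr 1
    ext ω
    simp only [Set.mem_inter_iff, Set.mem_ofPred_eq]
    tauto
  rw [joint_eq r₃, joint_eq true]
  field_simp
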